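/- Scalar Matignon stability (sufficient direction via the kernel): for 0 < α < 1 and a real scalar a < 0, the solution x(t) = E_α(a t^α) of the Caputo IVP ᶜD^α x = a x, x(0) = 1 satisfies 0 < x(t) ≤ 1 for all t ≥ 0 and x(t) → 0 as t → ∞. -/

import Mathlib

open Filter

/-- One-parameter Mittag–Leffler function (real argument). -/
noncomputable def mittagLeffler (α : ℝ) (z : ℝ) : ℝ :=
  ∑' k : ℕ, z ^ k / Real.Gamma (α * k + 1)

open MeasureTheory

def MLGood (μ : Measure ℝ) (c : ℝ → ℝ) : Prop :=
  IsProbabilityMeasure μ ∧ (∀ᵐ x ∂μ, 0 < x ∧ x ≤ 1) ∧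
    ∀ z : ℝ, -1 < z → Integrable (fun x : ℝ => x ^ z) μ ∧ ∫ x, x ^ z ∂μ = c z

lemma ml_meas_set : MeasurableSet {x : ℝ | 0 < x ∧ x ≤ 1} := measurableSet_Ioc

lemma ml_meas_pow (z : ℝ) : Measurable (fun x : ℝ => x ^ z) := by fun_prop

lemma ml_unif (j : ℝ) (hj : 1 ≤ j) :
    ∃ ν : Measure ℝ, MLGood ν (fun z => j / (j + z)) := by
  have hm : Measurable (fun u : ℝ => u ^ (1 / j)) := ml_meas_pow _
  have hj0 : 0 < j := by linarith
  refine ⟨Measure.map (fun u : ℝ => u ^ (1 / j)) (volume.restrict (Set.Ioc 0 1)), ?_, ?_, ?_⟩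
  · have : IsProbabilityMeasure (volume.restrict (Set.Ioc (0:ℝ) 1)) := ⟨by simp⟩
    exact Measure.isProbabilityMeasure_map hm.aemeasurable
  · rw [ae_map_iff hm.aemeasurable ml_meas_set]
    refine (ae_restrict_iff' measurableSet_Ioc).2 (Eventually.of_forall ?_)
    intro u hu
    exact ⟨Real.rpow_pos_of_pos hu.1 _, Real.rpow_le_one hu.1.le hu.2 (by positivity)⟩
  · intro z hz
    have hz' : -1 < z / j := by rw [lt_div_iff₀ hj0]; linarith
    have heq : Set.EqOn (fun u : ℝ => u ^ (z / j)) (fun u : ℝ => (u ^ (1 / j)) ^ z) (Set.Ioc 0 1) := by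
      intro u hu
      simp only
      rw [← Real.rpow_mul hu.1.le]
      congr 1; ring
    constructor
    · rw [integrable_map_measure (ml_meas_pow z).aestronglyMeasurable hm.aemeasurable]
      have h := (intervalIntegral.intervalIntegrable_rpow' (a := 0) (b := 1) hz')
      rw [intervalIntegrable_iff_integrableOn_Ioc_of_le zero_le_one] at h
      exact h.congr_fun heq measurableSet_Ioc
    · rw [integral_map hm.aemeasurable (ml_meas_pow z).aestronglyMeasurable]
      rw [← setIntegral_congr_fun measurableSet_Ioc heq,
        ← intervalIntegral.integral_of_le zero_le_one, integral_rpow (Or.inl hz')]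
      have h1 : z / j + 1 ≠ 0 := by linarith
      have h2 : j + z ≠ 0 := by linarith
      rw [Real.one_rpow, Real.zero_rpow h1]
      have : z / j + 1 = (j + z) / j := by field_simp; ring
      rw [this]; field_simp; ring

lemma ml_mix (α : ℝ) (hα0 : 0 < α) (hα1 : α < 1) (j : ℝ) (hj : 1 ≤ j) :
    ∃ ν : Measure ℝ, MLGood ν (fun z => (j + α * z) / (j + z)) := by
  obtain ⟨ν, hp, hae, hz⟩ := ml_unif j hj
  refine ⟨ENNReal.ofReal α • Measure.dirac 1 + ENNReal.ofReal (1 - α) • ν, ?_, ?_, ?_⟩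
  · constructor
    simp only [Measure.add_apply, Measure.smul_apply, measure_univ, smul_eq_mul, mul_one]
    rw [← ENNReal.ofReal_add hα0.le (by linarith)]
    simp
  · rw [ae_add_measure_iff]
    constructor
    · apply Measure.ae_smul_measure
      rw [ae_dirac_iff ml_meas_set]; norm_num
    · exact Measure.ae_smul_measure hae _
  · intro z hz1
    obtain ⟨hi, he⟩ := hz z hz1
    have i1 : Integrable (fun x : ℝ => x ^ z) (ENNReal.ofReal α • Measure.dirac (1:ℝ)) :=
      (integrable_dirac (by simp)).smul_measure (by simp)
    have i2 := hi.smul_measure (c := ENNReal.ofReal (1 - α)) (by simp)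
    refine ⟨i1.add_measure i2, ?_⟩
    rw [integral_add_measure i1 i2, integral_smul_measure, integral_smul_measure, he,
      integral_dirac, ENNReal.toReal_ofReal hα0.le, ENNReal.toReal_ofReal (by linarith)]
    have h2 : j + z ≠ 0 := by linarith
    simp only [Real.one_rpow, smul_eq_mul]
    field_simp; ring

lemma ml_mul {μ ν : Measure ℝ} {c d : ℝ → ℝ} (h1 : MLGood μ c) (h2 : MLGood ν d) :
    ∃ ρ : Measure ℝ, MLGood ρ (fun z => c z * d z) := by
  obtain ⟨hp, hae, hz⟩ := h1
  obtain ⟨hp', hae', hz'⟩ := h2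
  have hm : Measurable (fun p : ℝ × ℝ => p.1 * p.2) := by fun_prop
  have ha1 := Measure.quasiMeasurePreserving_fst (μ := μ) (ν := ν) |>.ae hae
  have ha2 := Measure.quasiMeasurePreserving_snd (μ := μ) (ν := ν) |>.ae hae'
  refine ⟨Measure.map (fun p : ℝ × ℝ => p.1 * p.2) (μ.prod ν), ?_, ?_, ?_⟩
  · exact Measure.isProbabilityMeasure_map hm.aemeasurable
  · rw [ae_map_iff hm.aemeasurable ml_meas_set]
    filter_upwards [ha1, ha2] with p q r
    exact ⟨mul_pos q.1 r.1, mul_le_one₀ q.2 r.1.le r.2⟩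
  · intro z hz1
    have heq : (fun p : ℝ × ℝ => p.1 ^ z * p.2 ^ z) =ᵐ[μ.prod ν] (fun p => (p.1 * p.2) ^ z) := by
      filter_upwards [ha1, ha2] with p q r
      rw [Real.mul_rpow q.1.le r.1.le]
    constructor
    · rw [integrable_map_measure (ml_meas_pow z).aestronglyMeasurable hm.aemeasurable]
      exact ((hz z hz1).1.mul_prod (hz' z hz1).1).congr heq
    · rw [integral_map hm.aemeasurable (ml_meas_pow z).aestronglyMeasurable,
        ← integral_congr_ae heq]
      rw [integral_prod_mul (fun x : ℝ => x ^ z) (fun x : ℝ => x ^ z), (hz z hz1).2, (hz' z hz1).2]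

lemma ml_exists (α : ℝ) (hα0 : 0 < α) (hα1 : α < 1) (n : ℕ) :
    ∃ ν : Measure ℝ, MLGood ν
      (fun z => ∏ j ∈ Finset.range n, ((1 + α * z + j) / (1 + z + j))) := by
  induction n with
  | zero =>
    refine ⟨Measure.dirac 1, inferInstance, ?_, ?_⟩
    · rw [ae_dirac_iff ml_meas_set]; norm_num
    · intro z _
      exact ⟨integrable_dirac (by simp), by simp⟩
  | succ n ih =>
    obtain ⟨μ, hμ⟩ := ih
    obtain ⟨ν, hν⟩ := ml_mix α hα0 hα1 (n + 1) (by simp)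
    obtain ⟨ρ, hρ⟩ := ml_mul hμ hν
    refine ⟨ρ, ?_⟩
    convert hρ using 2 with z
    rw [Finset.prod_range_succ]
    congr 2 <;> ring

noncomputable def mlM (α : ℝ) (n : ℕ) (z : ℝ) : ℝ :=
  ((n : ℝ) ^ (1 - α)) ^ z * ∏ j ∈ Finset.range (n + 1), ((1 + α * z + j) / (1 + z + j))

lemma mlM_tendsto (α : ℝ) (hα0 : 0 < α) (hα1 : α < 1) (z : ℝ) (hz : -1 < z) :
    Tendsto (fun n => mlM α n z) atTop (nhds (Real.Gamma (1 + z) / Real.Gamma (1 + α * z))) := by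
  have hz2 : 0 < 1 + α * z := by nlinarith
  have h := (Real.GammaSeq_tendsto_Gamma (1 + z)).div (Real.GammaSeq_tendsto_Gamma (1 + α * z))
    (Real.Gamma_pos_of_pos hz2).ne'
  refine h.congr' ?_
  filter_upwards [eventually_gt_atTop 0] with n hn
  have hn' : (0:ℝ) < n := by exact_mod_cast hn
  simp only [Pi.div_apply, Real.GammaSeq, mlM]
  rw [Finset.prod_div_distrib, ← Real.rpow_mul hn'.le]
  have e : (n:ℝ) ^ (1 + z) = (n:ℝ) ^ ((1 - α) * z) * (n:ℝ) ^ (1 + α * z) := by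
    rw [← Real.rpow_add hn']; congr 1; ring
  rw [e]
  have p1 : 0 < ∏ j ∈ Finset.range (n + 1), (1 + z + (j:ℝ)) :=
    Finset.prod_pos fun j _ => by have : (0:ℝ) ≤ j := by positivity
                                  linarith
  have p2 : 0 < ∏ j ∈ Finset.range (n + 1), (1 + α * z + (j:ℝ)) :=
    Finset.prod_pos fun j _ => by positivity
  have p3 : 0 < (n:ℝ) ^ (1 + α * z) := Real.rpow_pos_of_pos hn' _
  have p4 : (0:ℝ) < n.factorial := by positivity
  field_simp

lemma mlM_nonneg (α : ℝ) (hα0 : 0 < α) (n : ℕ) (z : ℝ) (hz : 0 ≤ z) : 0 ≤ mlM α n z := by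
  unfold mlM
  exact mul_nonneg (by positivity) (Finset.prod_nonneg fun j _ => by positivity)

lemma mlM_le_succ (α : ℝ) (hα0 : 0 < α) (hα1 : α < 1) (n : ℕ) (hn : 0 < n) (z : ℝ) (hz : 0 ≤ z) :
    mlM α n z ≤ mlM α (n + 1) z := by
  have hn' : (0:ℝ) < n := by exact_mod_cast hn
  unfold mlM
  rw [Finset.prod_range_succ _ (n + 1)]
  have hP : 0 ≤ ∏ j ∈ Finset.range (n + 1), ((1 + α * z + (j:ℝ)) / (1 + z + j)) :=
    Finset.prod_nonneg fun j _ => by positivity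
  rw [← Real.rpow_mul (by positivity), ← Real.rpow_mul (by positivity)]
  set p := (1 - α) * z with hp
  have hp0 : 0 ≤ p := mul_nonneg (by linarith) hz
  have key : (n:ℝ) ^ p ≤ ((n + 1 : ℕ) : ℝ) ^ p *
      ((1 + α * z + ((n + 1 : ℕ):ℝ)) / (1 + z + ((n + 1 : ℕ):ℝ))) := by
    push_cast
    have e : ((n:ℝ) + 1) = n * (1 + 1 / n) := by field_simp
    have e2 : ((n:ℝ) + 1) ^ p = (n:ℝ) ^ p * (1 + 1 / n) ^ p := by
      conv_lhs => rw [e]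
      rw [Real.mul_rpow hn'.le (by positivity)]
    rw [e2, mul_assoc]
    apply le_mul_of_one_le_right (by positivity)
    have hlog : 1 / ((n:ℝ) + 1) ≤ Real.log (1 + 1 / n) := by
      have := Real.one_sub_inv_le_log_of_pos (x := 1 + 1 / (n:ℝ)) (by positivity)
      convert this using 1
      field_simp; ring
    have h1 : 1 + p / (n + 1) ≤ (1 + 1 / (n:ℝ)) ^ p := by
      rw [Real.rpow_def_of_pos (by positivity)]
      have h3 := Real.add_one_le_exp (Real.log (1 + 1 / (n:ℝ)) * p)
      have h4 := mul_le_mul_of_nonneg_right hlog hp0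
      have h5 : p / ((n:ℝ) + 1) = 1 / ((n:ℝ) + 1) * p := by ring
      linarith
    have hD : 0 < 1 + z + ((n:ℝ) + 1) := by positivity
    rw [← mul_div_assoc, le_div_iff₀ hD, one_mul]
    have hN : 0 < 1 + α * z + ((n:ℝ) + 1) := by positivity
    refine le_trans ?_ (mul_le_mul_of_nonneg_right h1 hN.le)
    have h6 : p ≤ p / (n + 1) * (1 + α * z + ((n:ℝ) + 1)) := by
      rw [div_mul_eq_mul_div, le_div_iff₀ (by positivity)]
      apply mul_le_mul_of_nonneg_left _ hp0
      have : 0 ≤ α * z := by positivity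
      linarith
    have : p = z - α * z := by rw [hp]; ring
    linarith
  calc _ ≤ (((n + 1 : ℕ) : ℝ) ^ p *
      ((1 + α * z + ((n + 1 : ℕ):ℝ)) / (1 + z + ((n + 1 : ℕ):ℝ)))) * _ :=
        mul_le_mul_of_nonneg_right key hP
    _ = _ := by ring

lemma mlM_le (α : ℝ) (hα0 : 0 < α) (hα1 : α < 1) (n : ℕ) (hn : 0 < n) (z : ℝ) (hz : 0 ≤ z) :
    mlM α n z ≤ Real.Gamma (1 + z) / Real.Gamma (1 + α * z) := by
  obtain ⟨m, rfl⟩ : ∃ m, n = m + 1 := ⟨n - 1, by omega⟩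
  have hmono : Monotone (fun m => mlM α (m + 1) z) :=
    monotone_nat_of_le_succ fun m => mlM_le_succ α hα0 hα1 (m + 1) (by omega) z hz
  exact hmono.ge_of_tendsto
    ((mlM_tendsto α hα0 hα1 z (by linarith)).comp (tendsto_add_atTop_nat 1)) m

lemma ml_gamma_lower (R x : ℝ) (hR : 0 < R) (hx : 0 ≤ x) :
    R ^ x * Real.exp (-R) ≤ Real.Gamma (x + 1) := by
  rw [Real.Gamma_eq_integral (by linarith)]
  have hi := Real.GammaIntegral_convergent (s := x + 1) (by linarith)
  have hsub : Set.Ioi R ⊆ Set.Ioi (0:ℝ) := Set.Ioi_subset_Ioi hR.le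
  calc R ^ x * Real.exp (-R) = ∫ t in Set.Ioi R, R ^ x * Real.exp (-t) := by
        rw [integral_const_mul, integral_exp_neg_Ioi]
    _ ≤ ∫ t in Set.Ioi R, Real.exp (-t) * t ^ (x + 1 - 1) := by
        apply setIntegral_mono_on _ (hi.mono_set hsub) measurableSet_Ioi
        · intro t ht
          rw [add_sub_cancel_right, mul_comm]
          exact mul_le_mul_of_nonneg_left (Real.rpow_le_rpow hR.le (le_of_lt ht) hx)
            (Real.exp_pos _).le
        · exact (integrableOn_exp_neg_Ioi R).const_mul _
    _ ≤ _ := by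
        apply setIntegral_mono_set hi _ (Eventually.of_forall hsub)
        refine (ae_restrict_iff' measurableSet_Ioi).2 (Eventually.of_forall ?_)
        intro t ht
        have : (0:ℝ) < t := ht
        simp only [Pi.zero_apply]
        positivity

lemma ml_summable (α : ℝ) (hα0 : 0 < α) (s : ℝ) (hs : 0 ≤ s) :
    Summable (fun k : ℕ => s ^ k / Real.Gamma (1 + α * k)) := by
  set R := (2 * s + 1) ^ (1 / α) with hRdef
  have hR : 0 < R := by positivity
  have hRk : ∀ k : ℕ, R ^ (α * k) = (2 * s + 1) ^ k := by
    intro k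
    rw [hRdef, ← Real.rpow_mul (by positivity), ← Real.rpow_natCast]
    congr 1; field_simp
  have hr : s / (2 * s + 1) < 1 := by rw [div_lt_one (by positivity)]; linarith
  refine Summable.of_nonneg_of_le (fun k => ?_) (fun k => ?_)
    ((summable_geometric_of_lt_one (by positivity) hr).mul_left (Real.exp R))
  · have := Real.Gamma_pos_of_pos (s := 1 + α * k) (by positivity)
    positivity
  · have h := ml_gamma_lower R (α * k) hR (by positivity)
    rw [hRk] at h
    rw [add_comm 1 (α * (k:ℝ))]
    refine (div_le_div_of_nonneg_left (pow_nonneg hs k) (by positivity) h).trans (le_of_eq ?_)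
    rw [Real.exp_neg, div_pow]
    field_simp

lemma ml_F (α : ℝ) (hα0 : 0 < α) (hα1 : α < 1) (s : ℝ) (hs : 0 ≤ s) (n : ℕ) (hn : 0 < n) :
    ∃ F : ℝ, HasSum (fun k : ℕ => (-s) ^ k / k.factorial * mlM α n k) F ∧
      F ≤ 1 ∧ Real.exp (-(s * mlM α n 1)) ≤ F ∧
      (0 < s → F ≤ s ^ (-(1/2) : ℝ) * mlM α n (-(1/2))) := by
  obtain ⟨μ, hp, hae, hz⟩ := ml_exists α hα0 hα1 (n + 1)
  have hn' : (0:ℝ) < n := by exact_mod_cast hn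
  set N : ℝ := (n:ℝ) ^ (1 - α) with hN
  have hN0 : 0 < N := Real.rpow_pos_of_pos hn' _
  have hM : ∀ z : ℝ, -1 < z → Integrable (fun x : ℝ => N ^ z * x ^ z) μ ∧
      ∫ x, N ^ z * x ^ z ∂μ = mlM α n z := by
    intro z h
    refine ⟨(hz z h).1.const_mul _, ?_⟩
    rw [integral_const_mul, (hz z h).2]; rfl
  have hmeas : Measurable (fun x : ℝ => Real.exp (-(s * (N * x)))) := by fun_prop
  have hle1 : ∀ᵐ x ∂μ, Real.exp (-(s * (N * x))) ≤ 1 := by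
    filter_upwards [hae] with x hx
    have := hx.1
    apply Real.exp_le_one_iff.2
    have : 0 ≤ s * (N * x) := by positivity
    linarith
  have hint : Integrable (fun x : ℝ => Real.exp (-(s * (N * x)))) μ := by
    refine Integrable.of_bound hmeas.aestronglyMeasurable 1 ?_
    filter_upwards [hle1] with x hx
    rwa [Real.norm_eq_abs, abs_of_pos (Real.exp_pos _)]
  refine ⟨∫ x, Real.exp (-(s * (N * x))) ∂μ, ?_, ?_, ?_, ?_⟩
  · have hterm : ∀ k : ℕ, (-s) ^ k / k.factorial * mlM α n k =
        ∫ x, (-s) ^ k / k.factorial * (N ^ (k:ℝ) * x ^ (k:ℝ)) ∂μ := by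
      intro k
      have : (-1:ℝ) < k := lt_of_lt_of_le (by norm_num) (Nat.cast_nonneg k)
      rw [integral_const_mul, (hM k this).2]
    simp_rw [hterm]
    have hsumm : Summable (fun k : ℕ => (s * N) ^ k / (k.factorial : ℝ)) :=
      Real.summable_pow_div_factorial _
    refine hasSum_integral_of_dominated_convergence
      (fun k _ => (s * N) ^ k / (k.factorial : ℝ)) ?_ ?_ ?_ ?_ ?_
    · intro k
      exact Measurable.aestronglyMeasurable (by fun_prop)
    · intro k
      filter_upwards [hae] with x hx
      have h0 := hx.1
      rw [Real.rpow_natCast, Real.rpow_natCast, Real.norm_eq_abs, abs_mul, abs_div, abs_pow,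
        abs_neg, abs_of_nonneg hs, abs_of_nonneg (by positivity : (0:ℝ) ≤ N ^ k * x ^ k),
        abs_of_nonneg (by positivity : (0:ℝ) ≤ (k.factorial:ℝ))]
      have h1 : x ^ k ≤ 1 := pow_le_one₀ h0.le hx.2
      rw [mul_pow, mul_div_right_comm]
      gcongr
      exact mul_le_of_le_one_right (by positivity) h1
    · exact Eventually.of_forall fun _ => hsumm
    · exact integrable_const _
    · refine Eventually.of_forall fun x => ?_
      have h := NormedSpace.expSeries_div_hasSum_exp (𝔸 := ℝ) (-(s * (N * x)))
      rw [← Real.exp_eq_exp_ℝ] at h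
      have hfe : (fun k : ℕ => (-s) ^ k / (k.factorial : ℝ) * (N ^ (k:ℝ) * x ^ (k:ℝ))) =
          fun k : ℕ => (-(s * (N * x))) ^ k / (k.factorial : ℝ) := by
       funext k
       rw [Real.rpow_natCast, Real.rpow_natCast, ← mul_pow, div_mul_eq_mul_div, ← mul_pow]
       congr 2; ring
      rw [hfe]; exact h
  · calc _ ≤ ∫ _, (1:ℝ) ∂μ := integral_mono_ae hint (integrable_const _) hle1
      _ = 1 := by simp
  · obtain ⟨i1, e1⟩ := hM 1 (by norm_num)
    set m := mlM α n 1
    have hbound : ∀ x : ℝ, Real.exp (-(s * m)) * (1 + s * m) -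
        Real.exp (-(s * m)) * s * (N ^ (1:ℝ) * x ^ (1:ℝ)) ≤ Real.exp (-(s * (N * x))) := by
      intro x
      have h := Real.add_one_le_exp (s * m - s * (N * x))
      have h2 : Real.exp (-(s * (N * x))) = Real.exp (-(s * m)) * Real.exp (s * m - s * (N * x)) := by
        rw [← Real.exp_add]; congr 1; ring
      rw [h2, Real.rpow_one, Real.rpow_one]
      have := mul_le_mul_of_nonneg_left h (Real.exp_pos (-(s * m))).le
      linarith
    have i2 := i1.const_mul (Real.exp (-(s * m)) * s)
    have h := integral_mono ((integrable_const (μ := μ) (Real.exp (-(s * m)) * (1 + s * m))).sub i2)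
      hint hbound
    refine le_trans (le_of_eq ?_) h
    simp only [Pi.sub_apply]
    rw [integral_sub (integrable_const _) i2,
      integral_const_mul (Real.exp (-(s * m)) * s) (fun x : ℝ => N ^ (1:ℝ) * x ^ (1:ℝ)), e1]
    simp
    ring
  · intro hs0
    obtain ⟨i1, e1⟩ := hM (-(1/2)) (by norm_num)
    rw [← e1, ← integral_const_mul]
    refine integral_mono_ae hint (i1.const_mul _) ?_
    filter_upwards [hae] with x hx
    have h0 := hx.1
    rw [← Real.mul_rpow hN0.le h0.le, ← Real.mul_rpow hs0.le (by positivity)]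
    set y := s * (N * x) with hy
    have hy0 : 0 < y := by positivity
    rw [Real.rpow_def_of_pos hy0]
    apply Real.exp_le_exp.2
    have := Real.log_le_sub_one_of_pos hy0
    linarith

lemma ml_main (α : ℝ) (hα0 : 0 < α) (hα1 : α < 1) : ∃ C : ℝ, ∀ s : ℝ, 0 ≤ s →
    0 < mittagLeffler α (-s) ∧ mittagLeffler α (-s) ≤ 1 ∧
      (0 < s → mittagLeffler α (-s) ≤ s ^ (-(1/2) : ℝ) * C) := by
  refine ⟨Real.Gamma (1 + -(1/2)) / Real.Gamma (1 + α * (-(1/2))), fun s hs => ?_⟩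
  have hk : ∀ k : ℕ, (-1:ℝ) < k := fun k => lt_of_lt_of_le (by norm_num) (Nat.cast_nonneg k)
  have hT : Tendsto (fun n => ∑' k : ℕ, (-s) ^ k / k.factorial * mlM α n k) atTop
      (nhds (mittagLeffler α (-s))) := by
    unfold mittagLeffler
    refine tendsto_tsum_of_dominated_convergence (ml_summable α hα0 s hs) ?_ ?_
    · intro k
      have h := (mlM_tendsto α hα0 hα1 k (hk k)).const_mul ((-s) ^ k / (k.factorial : ℝ))
      convert h using 2
      rw [add_comm (1:ℝ) (k:ℝ), Real.Gamma_nat_eq_factorial, add_comm (1:ℝ)]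
      have : (0:ℝ) < k.factorial := by positivity
      field_simp
    · filter_upwards [eventually_gt_atTop 0] with n hn k
      have h := mlM_le α hα0 hα1 n hn k (by positivity)
      rw [Real.norm_eq_abs, abs_mul, abs_div, abs_pow, abs_neg, abs_of_nonneg hs,
        abs_of_nonneg (mlM_nonneg α hα0 n k (by positivity)),
        abs_of_nonneg (by positivity : (0:ℝ) ≤ (k.factorial:ℝ))]
      refine (mul_le_mul_of_nonneg_left h (by positivity)).trans (le_of_eq ?_)
      rw [add_comm (1:ℝ) (k:ℝ), Real.Gamma_nat_eq_factorial]
      have : (0:ℝ) < k.factorial := by positivity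
      field_simp
  refine ⟨?_, ?_, ?_⟩
  · have h1 := ((mlM_tendsto α hα0 hα1 1 (by norm_num)).const_mul s).neg.rexp
    refine lt_of_lt_of_le (Real.exp_pos _) (le_of_tendsto_of_tendsto h1 hT ?_)
    filter_upwards [eventually_gt_atTop 0] with n hn
    obtain ⟨F, hF, _, h, _⟩ := ml_F α hα0 hα1 s hs n hn
    rw [hF.tsum_eq]; exact h
  · refine le_of_tendsto hT ?_
    filter_upwards [eventually_gt_atTop 0] with n hn
    obtain ⟨F, hF, h, _, _⟩ := ml_F α hα0 hα1 s hs n hn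
    rw [hF.tsum_eq]; exact h
  · intro hs0
    have h1 := (mlM_tendsto α hα0 hα1 (-(1/2)) (by norm_num)).const_mul (s ^ (-(1/2) : ℝ))
    refine le_of_tendsto_of_tendsto hT h1 ?_
    filter_upwards [eventually_gt_atTop 0] with n hn
    obtain ⟨F, hF, _, _, h⟩ := ml_F α hα0 hα1 s hs n hn
    rw [hF.tsum_eq]; exact h hs0

/-- Scalar Matignon stability (sufficient direction): for `0 < α < 1` and `a < 0`,
the solution `x(t) = E_α(a t^α)` of `ᶜD^α x = a x`, `x(0)=1`, satisfies
`0 < x(t) ≤ 1` for all `t ≥ 0` and `x(t) → 0` as `t → ∞`. -/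
theorem matignon_scalar_stability
    (α : ℝ) (hα0 : 0 < α) (hα1 : α < 1) (a : ℝ) (ha : a < 0) :
    (∀ t : ℝ, 0 ≤ t →
      0 < mittagLeffler α (a * t ^ α) ∧ mittagLeffler α (a * t ^ α) ≤ 1) ∧
    Tendsto (fun t : ℝ => mittagLeffler α (a * t ^ α)) atTop (nhds 0) := by
  obtain ⟨C, hC⟩ := ml_main α hα0 hα1
  have hs : ∀ t : ℝ, 0 ≤ t → 0 ≤ (-a) * t ^ α := fun t ht =>
    mul_nonneg (by linarith) (Real.rpow_nonneg ht _)
  have e : ∀ t : ℝ, a * t ^ α = -((-a) * t ^ α) := fun t => by ring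
  refine ⟨fun t ht => ?_, ?_⟩
  · rw [e]
    exact ⟨(hC _ (hs t ht)).1, (hC _ (hs t ht)).2.1⟩
  · have h1 : Tendsto (fun t : ℝ => (-a) * t ^ α) atTop atTop :=
      (tendsto_rpow_atTop hα0).const_mul_atTop (by linarith)
    have h2 := ((tendsto_rpow_neg_atTop (y := 1/2) (by norm_num)).comp h1).mul_const C
    rw [zero_mul] at h2
    refine squeeze_zero' ?_ ?_ h2
    · filter_upwards [eventually_ge_atTop 0] with t ht
      rw [e]
      exact (hC _ (hs t ht)).1.le
    · filter_upwards [eventually_gt_atTop 0] with t ht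
      rw [e]
      exact (hC _ (hs t ht.le)).2.2 (mul_pos (by linarith) (Real.rpow_pos_of_pos ht _))
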